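/- The minimal degrees of nontrivial Jacobian relations of Q1 and Q2 differ: mdr(Q1) = 4 while mdr(Q2) = 3, where Q1 = (x^2+y^2-25z^2)(x-4z)(x+4z)(3x+4y)(x+3z)(6x+y+21z)(y+3z) and Q2 = (x^2+y^2-25z^2)(x+4z)·x·(x-4z)(y-3z)(y+3z)(3x-4y). -/

import Mathlib

open MvPolynomial

noncomputable def Q1 : MvPolynomial (Fin 3) ℂ :=
  (X 0 ^ 2 + X 1 ^ 2 - 25 * X 2 ^ 2) * (X 0 - 4 * X 2) * (X 0 + 4 * X 2) *
    (3 * X 0 + 4 * X 1) * (X 0 + 3 * X 2) * (6 * X 0 + X 1 + 21 * X 2) * (X 1 + 3 * X 2)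

noncomputable def Q2 : MvPolynomial (Fin 3) ℂ :=
  (X 0 ^ 2 + X 1 ^ 2 - 25 * X 2 ^ 2) * (X 0 + 4 * X 2) * X 0 * (X 0 - 4 * X 2) *
    (X 1 - 3 * X 2) * (X 1 + 3 * X 2) * (3 * X 0 - 4 * X 1)

/-- The minimal degree of a nontrivial Jacobian relation of `f`. -/
noncomputable def mdr (f : MvPolynomial (Fin 3) ℂ) : ℕ :=
  sInf {r : ℕ | ∃ a b c : MvPolynomial (Fin 3) ℂ,
    ¬ (a = 0 ∧ b = 0 ∧ c = 0) ∧
    a.IsHomogeneous r ∧ b.IsHomogeneous r ∧ c.IsHomogeneous r ∧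
    a * pderiv 0 f + b * pderiv 1 f + c * pderiv 2 f = 0}


/-- A homogeneous polynomial in three variables, evaluated through its coefficients. -/
lemma homog_eval {n : ℕ} {p : MvPolynomial (Fin 3) ℂ} (hp : p.IsHomogeneous n) :
    ∃ k : ℕ → ℕ → ℂ, ∀ x y z : ℂ, eval ![x, y, z] p =
      ∑ i ∈ Finset.range (n + 1), ∑ j ∈ Finset.range (n + 1 - i),
        k i j * x ^ i * y ^ j * z ^ (n - i - j) := by
  have key : ∀ s : Finset (Fin 3 →₀ ℕ), s ⊆ p.support →
      ∃ k : ℕ → ℕ → ℂ, ∀ x y z : ℂ, eval ![x, y, z] (∑ d ∈ s, monomial d (coeff d p)) =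
      ∑ i ∈ Finset.range (n + 1), ∑ j ∈ Finset.range (n + 1 - i),
        k i j * x ^ i * y ^ j * z ^ (n - i - j) := by
    classical
    intro s
    induction s using Finset.induction_on with
    | empty => intro _; exact ⟨fun _ _ => 0, by simp⟩
    | insert d s hd ih =>
      intro hs
      obtain ⟨k, hk⟩ := ih (fun t ht => hs (Finset.mem_insert_of_mem ht))
      have hdeg : d 0 + d 1 + d 2 = n := by
        have h1 := hp (mem_support_iff.mp (hs (Finset.mem_insert_self d s)))
        rw [Finsupp.weight_apply, Finsupp.sum_fintype _ _ (by simp)] at h1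
        simpa [Fin.sum_univ_three] using h1
      refine ⟨fun i j => (if i = d 0 then (if j = d 1 then coeff d p else 0) else 0) + k i j, ?_⟩
      intro x y z
      rw [Finset.sum_insert hd, map_add, hk]
      simp only [add_mul, Finset.sum_add_distrib]
      congr 1
      rw [Finset.sum_eq_single (d 0), Finset.sum_eq_single (d 1)]
      · have h2 : n - d 0 - d 1 = d 2 := by omega
        rw [eval_monomial, Finsupp.prod_fintype _ _ (by simp), h2]
        simp [Fin.prod_univ_three]
        ring
      · intro j _ hj; simp [hj]
      · intro hj; exact absurd (Finset.mem_range.mpr (by omega)) hj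
      · intro i _ hi; simp [hi]
      · intro hi; exact absurd (Finset.mem_range.mpr (by omega)) hi
  obtain ⟨k, hk⟩ := key p.support subset_rfl
  exact ⟨k, by rw [← as_sum p] at hk; exact hk⟩

lemma eq_zero_of_eval {p : MvPolynomial (Fin 3) ℂ} (h : ∀ x y z : ℂ, eval ![x, y, z] p = 0) :
    p = 0 := by
  apply MvPolynomial.funext
  intro v
  have hv : v = ![v 0, v 1, v 2] := by ext i; fin_cases i <;> rfl
  rw [hv, h, map_zero]

/-- The set of degrees of nontrivial Jacobian relations is upward closed. -/
lemma rel_up {f : MvPolynomial (Fin 3) ℂ} {r n : ℕ} (hrn : r ≤ n)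
    (h : ∃ a b c : MvPolynomial (Fin 3) ℂ,
      ¬ (a = 0 ∧ b = 0 ∧ c = 0) ∧
      a.IsHomogeneous r ∧ b.IsHomogeneous r ∧ c.IsHomogeneous r ∧
      a * pderiv 0 f + b * pderiv 1 f + c * pderiv 2 f = 0) :
    ∃ a b c : MvPolynomial (Fin 3) ℂ,
      ¬ (a = 0 ∧ b = 0 ∧ c = 0) ∧
      a.IsHomogeneous n ∧ b.IsHomogeneous n ∧ c.IsHomogeneous n ∧
      a * pderiv 0 f + b * pderiv 1 f + c * pderiv 2 f = 0 := by
  obtain ⟨a, b, c, h0, ha, hb, hc, h⟩ := h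
  have hX : ((X 0 : MvPolynomial (Fin 3) ℂ) ^ (n - r)).IsHomogeneous (n - r) :=
    isHomogeneous_X_pow 0 (n - r)
  have hne : (X 0 : MvPolynomial (Fin 3) ℂ) ^ (n - r) ≠ 0 := pow_ne_zero _ (X_ne_zero 0)
  have hn : n - r + r = n := by omega
  refine ⟨X 0 ^ (n - r) * a, X 0 ^ (n - r) * b, X 0 ^ (n - r) * c, ?_, ?_, ?_, ?_, ?_⟩
  · simpa [hne] using h0
  · have := hX.mul ha; rwa [hn] at this
  · have := hX.mul hb; rwa [hn] at this
  · have := hX.mul hc; rwa [hn] at this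
  · rw [mul_assoc, mul_assoc, mul_assoc, ← mul_add, ← mul_add, h, mul_zero]

lemma pderiv_ofNat' (i : Fin 3) (m : ℕ) [m.AtLeastTwo] :
    pderiv i (OfNat.ofNat m : MvPolynomial (Fin 3) ℂ) = 0 := by
  rw [← Nat.cast_ofNat (R := MvPolynomial (Fin 3) ℂ)]
  exact Derivation.map_natCast _ _

lemma pderiv_nums (i : Fin 3) :
    pderiv i (3 : MvPolynomial (Fin 3) ℂ) = 0 ∧ pderiv i (4 : MvPolynomial (Fin 3) ℂ) = 0 ∧
    pderiv i (6 : MvPolynomial (Fin 3) ℂ) = 0 ∧ pderiv i (21 : MvPolynomial (Fin 3) ℂ) = 0 ∧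
    pderiv i (25 : MvPolynomial (Fin 3) ℂ) = 0 :=
  ⟨pderiv_ofNat' i 3, pderiv_ofNat' i 4, pderiv_ofNat' i 6, pderiv_ofNat' i 21,
    pderiv_ofNat' i 25⟩

set_option maxHeartbeats 4000000 in
lemma Q1_d0 : pderiv 0 Q1 =
    (2 * X 0) * (X 0 - 4 * X 2) * (X 0 + 4 * X 2) * (3 * X 0 + 4 * X 1) * (X 0 + 3 * X 2) * (6 * X
    0 + X 1 + 21 * X 2) * (X 1 + 3 * X 2) + (1) * (X 0 ^ 2 + X 1 ^ 2 - 25 * X 2 ^ 2) * (X 0 + 4 *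
    X 2) * (3 * X 0 + 4 * X 1) * (X 0 + 3 * X 2) * (6 * X 0 + X 1 + 21 * X 2) * (X 1 + 3 * X 2) +
    (1) * (X 0 ^ 2 + X 1 ^ 2 - 25 * X 2 ^ 2) * (X 0 - 4 * X 2) * (3 * X 0 + 4 * X 1) * (X 0 + 3 *
    X 2) * (6 * X 0 + X 1 + 21 * X 2) * (X 1 + 3 * X 2) + (3) * (X 0 ^ 2 + X 1 ^ 2 - 25 * X 2 ^ 2)
    * (X 0 - 4 * X 2) * (X 0 + 4 * X 2) * (X 0 + 3 * X 2) * (6 * X 0 + X 1 + 21 * X 2) * (X 1 + 3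
    * X 2) + (1) * (X 0 ^ 2 + X 1 ^ 2 - 25 * X 2 ^ 2) * (X 0 - 4 * X 2) * (X 0 + 4 * X 2) * (3 * X
    0 + 4 * X 1) * (6 * X 0 + X 1 + 21 * X 2) * (X 1 + 3 * X 2) + (6) * (X 0 ^ 2 + X 1 ^ 2 - 25 *
    X 2 ^ 2) * (X 0 - 4 * X 2) * (X 0 + 4 * X 2) * (3 * X 0 + 4 * X 1) * (X 0 + 3 * X 2) * (X 1 +
    3 * X 2) := by
  obtain ⟨e3, e4, e6, e21, e25⟩ := pderiv_nums 0
  simp only [Q1, Derivation.leibniz, Derivation.leibniz_pow, map_add, map_sub, pderiv_X, e3, e4, e6, e21, e25,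
    smul_eq_mul]
  simp
  ring

set_option maxHeartbeats 4000000 in
lemma Q1_d1 : pderiv 1 Q1 =
    (2 * X 1) * (X 0 - 4 * X 2) * (X 0 + 4 * X 2) * (3 * X 0 + 4 * X 1) * (X 0 + 3 * X 2) * (6 * X
    0 + X 1 + 21 * X 2) * (X 1 + 3 * X 2) + (4) * (X 0 ^ 2 + X 1 ^ 2 - 25 * X 2 ^ 2) * (X 0 - 4 *
    X 2) * (X 0 + 4 * X 2) * (X 0 + 3 * X 2) * (6 * X 0 + X 1 + 21 * X 2) * (X 1 + 3 * X 2) + (1)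
    * (X 0 ^ 2 + X 1 ^ 2 - 25 * X 2 ^ 2) * (X 0 - 4 * X 2) * (X 0 + 4 * X 2) * (3 * X 0 + 4 * X 1)
    * (X 0 + 3 * X 2) * (X 1 + 3 * X 2) + (1) * (X 0 ^ 2 + X 1 ^ 2 - 25 * X 2 ^ 2) * (X 0 - 4 * X
    2) * (X 0 + 4 * X 2) * (3 * X 0 + 4 * X 1) * (X 0 + 3 * X 2) * (6 * X 0 + X 1 + 21 * X 2) := by
  obtain ⟨e3, e4, e6, e21, e25⟩ := pderiv_nums 1
  simp only [Q1, Derivation.leibniz, Derivation.leibniz_pow, map_add, map_sub, pderiv_X, e3, e4, e6, e21, e25,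
    smul_eq_mul]
  simp
  ring

set_option maxHeartbeats 4000000 in
lemma Q1_d2 : pderiv 2 Q1 =
    (-50 * X 2) * (X 0 - 4 * X 2) * (X 0 + 4 * X 2) * (3 * X 0 + 4 * X 1) * (X 0 + 3 * X 2) * (6 *
    X 0 + X 1 + 21 * X 2) * (X 1 + 3 * X 2) + (-4) * (X 0 ^ 2 + X 1 ^ 2 - 25 * X 2 ^ 2) * (X 0 + 4
    * X 2) * (3 * X 0 + 4 * X 1) * (X 0 + 3 * X 2) * (6 * X 0 + X 1 + 21 * X 2) * (X 1 + 3 * X 2)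
    + (4) * (X 0 ^ 2 + X 1 ^ 2 - 25 * X 2 ^ 2) * (X 0 - 4 * X 2) * (3 * X 0 + 4 * X 1) * (X 0 + 3
    * X 2) * (6 * X 0 + X 1 + 21 * X 2) * (X 1 + 3 * X 2) + (3) * (X 0 ^ 2 + X 1 ^ 2 - 25 * X 2 ^
    2) * (X 0 - 4 * X 2) * (X 0 + 4 * X 2) * (3 * X 0 + 4 * X 1) * (6 * X 0 + X 1 + 21 * X 2) * (X
    1 + 3 * X 2) + (21) * (X 0 ^ 2 + X 1 ^ 2 - 25 * X 2 ^ 2) * (X 0 - 4 * X 2) * (X 0 + 4 * X 2) *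
    (3 * X 0 + 4 * X 1) * (X 0 + 3 * X 2) * (X 1 + 3 * X 2) + (3) * (X 0 ^ 2 + X 1 ^ 2 - 25 * X 2
    ^ 2) * (X 0 - 4 * X 2) * (X 0 + 4 * X 2) * (3 * X 0 + 4 * X 1) * (X 0 + 3 * X 2) * (6 * X 0 +
    X 1 + 21 * X 2) := by
  obtain ⟨e3, e4, e6, e21, e25⟩ := pderiv_nums 2
  simp only [Q1, Derivation.leibniz, Derivation.leibniz_pow, map_add, map_sub, pderiv_X, e3, e4, e6, e21, e25,
    smul_eq_mul]
  simp
  ring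

set_option maxHeartbeats 4000000 in
lemma Q1_lin (a b c : ℕ → ℕ → ℂ)
    (E : ∀ x y z : ℂ, (a 3 0 * x ^ 3 * y ^ 0 * z ^ 0 + a 2 1 * x ^ 2 * y ^ 1 * z ^ 0 + a 2 0 * x ^ 2 *
    y ^ 0 * z ^ 1 + a 1 2 * x ^ 1 * y ^ 2 * z ^ 0 + a 1 1 * x ^ 1 * y ^ 1 * z ^ 1 + a 1 0 * x ^ 1
    * y ^ 0 * z ^ 2 + a 0 3 * x ^ 0 * y ^ 3 * z ^ 0 + a 0 2 * x ^ 0 * y ^ 2 * z ^ 1 + a 0 1 * x ^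
    0 * y ^ 1 * z ^ 2 + a 0 0 * x ^ 0 * y ^ 0 * z ^ 3) * ((2 * x) * (x - 4 * z) * (x + 4 * z) * (3
    * x + 4 * y) * (x + 3 * z) * (6 * x + y + 21 * z) * (y + 3 * z) + (1) * (x ^ 2 + y ^ 2 - 25 *
    z ^ 2) * (x + 4 * z) * (3 * x + 4 * y) * (x + 3 * z) * (6 * x + y + 21 * z) * (y + 3 * z) +
    (1) * (x ^ 2 + y ^ 2 - 25 * z ^ 2) * (x - 4 * z) * (3 * x + 4 * y) * (x + 3 * z) * (6 * x + y
    + 21 * z) * (y + 3 * z) + (3) * (x ^ 2 + y ^ 2 - 25 * z ^ 2) * (x - 4 * z) * (x + 4 * z) * (x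
    + 3 * z) * (6 * x + y + 21 * z) * (y + 3 * z) + (1) * (x ^ 2 + y ^ 2 - 25 * z ^ 2) * (x - 4 *
    z) * (x + 4 * z) * (3 * x + 4 * y) * (6 * x + y + 21 * z) * (y + 3 * z) + (6) * (x ^ 2 + y ^ 2
    - 25 * z ^ 2) * (x - 4 * z) * (x + 4 * z) * (3 * x + 4 * y) * (x + 3 * z) * (y + 3 * z)) + (b
    3 0 * x ^ 3 * y ^ 0 * z ^ 0 + b 2 1 * x ^ 2 * y ^ 1 * z ^ 0 + b 2 0 * x ^ 2 * y ^ 0 * z ^ 1 +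
    b 1 2 * x ^ 1 * y ^ 2 * z ^ 0 + b 1 1 * x ^ 1 * y ^ 1 * z ^ 1 + b 1 0 * x ^ 1 * y ^ 0 * z ^ 2
    + b 0 3 * x ^ 0 * y ^ 3 * z ^ 0 + b 0 2 * x ^ 0 * y ^ 2 * z ^ 1 + b 0 1 * x ^ 0 * y ^ 1 * z ^
    2 + b 0 0 * x ^ 0 * y ^ 0 * z ^ 3) * ((2 * y) * (x - 4 * z) * (x + 4 * z) * (3 * x + 4 * y) *
    (x + 3 * z) * (6 * x + y + 21 * z) * (y + 3 * z) + (4) * (x ^ 2 + y ^ 2 - 25 * z ^ 2) * (x - 4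
    * z) * (x + 4 * z) * (x + 3 * z) * (6 * x + y + 21 * z) * (y + 3 * z) + (1) * (x ^ 2 + y ^ 2 -
    25 * z ^ 2) * (x - 4 * z) * (x + 4 * z) * (3 * x + 4 * y) * (x + 3 * z) * (y + 3 * z) + (1) *
    (x ^ 2 + y ^ 2 - 25 * z ^ 2) * (x - 4 * z) * (x + 4 * z) * (3 * x + 4 * y) * (x + 3 * z) * (6
    * x + y + 21 * z)) + (c 3 0 * x ^ 3 * y ^ 0 * z ^ 0 + c 2 1 * x ^ 2 * y ^ 1 * z ^ 0 + c 2 0 *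
    x ^ 2 * y ^ 0 * z ^ 1 + c 1 2 * x ^ 1 * y ^ 2 * z ^ 0 + c 1 1 * x ^ 1 * y ^ 1 * z ^ 1 + c 1 0
    * x ^ 1 * y ^ 0 * z ^ 2 + c 0 3 * x ^ 0 * y ^ 3 * z ^ 0 + c 0 2 * x ^ 0 * y ^ 2 * z ^ 1 + c 0
    1 * x ^ 0 * y ^ 1 * z ^ 2 + c 0 0 * x ^ 0 * y ^ 0 * z ^ 3) * ((-50 * z) * (x - 4 * z) * (x + 4
    * z) * (3 * x + 4 * y) * (x + 3 * z) * (6 * x + y + 21 * z) * (y + 3 * z) + (-4) * (x ^ 2 + y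
    ^ 2 - 25 * z ^ 2) * (x + 4 * z) * (3 * x + 4 * y) * (x + 3 * z) * (6 * x + y + 21 * z) * (y +
    3 * z) + (4) * (x ^ 2 + y ^ 2 - 25 * z ^ 2) * (x - 4 * z) * (3 * x + 4 * y) * (x + 3 * z) * (6
    * x + y + 21 * z) * (y + 3 * z) + (3) * (x ^ 2 + y ^ 2 - 25 * z ^ 2) * (x - 4 * z) * (x + 4 *
    z) * (3 * x + 4 * y) * (6 * x + y + 21 * z) * (y + 3 * z) + (21) * (x ^ 2 + y ^ 2 - 25 * z ^
    2) * (x - 4 * z) * (x + 4 * z) * (3 * x + 4 * y) * (x + 3 * z) * (y + 3 * z) + (3) * (x ^ 2 +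
    y ^ 2 - 25 * z ^ 2) * (x - 4 * z) * (x + 4 * z) * (3 * x + 4 * y) * (x + 3 * z) * (6 * x + y +
    21 * z)) = 0) :
    a 3 0 = 0 ∧ a 2 1 = 0 ∧ a 2 0 = 0 ∧ a 1 2 = 0 ∧ a 1 1 = 0 ∧ a 1 0 = 0 ∧ a 0 3 = 0 ∧ a 0 2 = 0
    ∧ a 0 1 = 0 ∧ a 0 0 = 0 ∧ b 3 0 = 0 ∧ b 2 1 = 0 ∧ b 2 0 = 0 ∧ b 1 2 = 0 ∧ b 1 1 = 0 ∧ b 1 0 =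
    0 ∧ b 0 3 = 0 ∧ b 0 2 = 0 ∧ b 0 1 = 0 ∧ b 0 0 = 0 ∧ c 3 0 = 0 ∧ c 2 1 = 0 ∧ c 2 0 = 0 ∧ c 1 2
    = 0 ∧ c 1 1 = 0 ∧ c 1 0 = 0 ∧ c 0 3 = 0 ∧ c 0 2 = 0 ∧ c 0 1 = 0 ∧ c 0 0 = 0 := by
  have h0 : b 3 0 + 3 * c 3 0 = 0 := by
    linear_combination (1 / 18) * E (-1) 0 0
  have h1 : 3 * a 0 0 + 4 * b 0 0 = 0 := by
    linear_combination (1 / 75600) * E 0 0 (-1)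
  have h2 : 27 * a 3 0 - 9 * a 2 0 + 3 * a 1 0 - a 0 0 + 81 * c 3 0 - 27 * c 2 0 + 9 * c 1 0 - 3 * c 0 0 = 0 := by
    linear_combination (1 / 9072) * E (-3) 0 1
  have h3 : 27 * b 0 3 - 9 * b 0 2 + 3 * b 0 1 - b 0 0 + 81 * c 0 3 - 27 * c 0 2 + 9 * c 0 1 - 3 * c 0 0 = 0 := by
    linear_combination (1 / 165888) * E 0 (-3) 1
  have h4 : -64 * a 3 0 - 16 * a 2 0 - 4 * a 1 0 - a 0 0 + 256 * c 3 0 + 64 * c 2 0 + 16 * c 1 0 + 4 * c 0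
    0 = 0 := by
    linear_combination (1 / 816480) * E (-4) 0 (-1)
  have h5 : 64 * a 3 0 - 16 * a 2 0 + 4 * a 1 0 - a 0 0 + 256 * c 3 0 - 64 * c 2 0 + 16 * c 1 0 - 4 * c 0
    0 = 0 := by
    linear_combination (1 / 7776) * E (-4) 0 1
  have h6 : 125 * a 3 0 + 25 * a 2 0 + 5 * a 1 0 + a 0 0 - 625 * c 3 0 - 125 * c 2 0 - 25 * c 1 0 - 5 * c
    0 0 = 0 := by
    linear_combination (1 / 1652400) * E (-5) 0 (-1)
  have h7 : -125 * a 3 0 + 25 * a 2 0 - 5 * a 1 0 + a 0 0 - 625 * c 3 0 + 125 * c 2 0 - 25 * c 1 0 + 5 * c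
    0 0 = 0 := by
    linear_combination (1 / 72900) * E (-5) 0 1
  have h8 : -125 * b 0 3 - 25 * b 0 2 - 5 * b 0 1 - b 0 0 + 625 * c 0 3 + 125 * c 0 2 + 25 * c 0 1 + 5 * c
    0 0 = 0 := by
    linear_combination (1 / 1996800) * E 0 (-5) (-1)
  have h9 : -125 * b 0 3 + 25 * b 0 2 - 5 * b 0 1 + b 0 0 - 625 * c 0 3 + 125 * c 0 2 - 25 * c 0 1 + 5 * c
    0 0 = 0 := by
    linear_combination (1 / 307200) * E 0 (-5) 1
  have h10 : 37 * a 3 0 + 37 * a 2 1 + 37 * a 1 2 + 37 * a 0 3 + 19 * b 3 0 + 19 * b 2 1 + 19 * b 1 2 + 19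
    * b 0 3 + 63 * c 3 0 + 63 * c 2 1 + 63 * c 1 2 + 63 * c 0 3 = 0 := by
    linear_combination (1 / 14) * E (-1) (-1) 0
  have h11 : 135 * a 0 3 + 45 * a 0 2 + 15 * a 0 1 + 5 * a 0 0 + 27 * b 0 3 + 9 * b 0 2 + 3 * b 0 1 + b 0 0
    + 1215 * c 0 3 + 405 * c 0 2 + 135 * c 0 1 + 45 * c 0 0 = 0 := by
    linear_combination (1 / 221184) * E 0 (-3) (-1)
  have h12 : -192 * a 3 0 + 144 * a 2 1 - 108 * a 1 2 + 81 * a 0 3 - 256 * b 3 0 + 192 * b 2 1 - 144 * b 1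
    2 + 108 * b 0 3 = 0 := by
    linear_combination (1 / 100800) * E (-4) 3 0
  have h13 : 7 * a 3 0 - 7 * a 2 0 + 7 * a 1 0 - 7 * a 0 0 - 56 * b 3 0 + 56 * b 2 0 - 56 * b 1 0 + 56 * b
    0 0 + 487 * c 3 0 - 487 * c 2 0 + 487 * c 1 0 - 487 * c 0 0 = 0 := by
    linear_combination (1 / 1620) * E (-1) 0 1
  have h14 : 11 * a 3 0 - 11 * a 2 1 + 11 * a 1 2 - 11 * a 0 3 - 29 * b 3 0 + 29 * b 2 1 - 29 * b 1 2 + 29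
    * b 0 3 + 21 * c 3 0 - 21 * c 2 1 + 21 * c 1 2 - 21 * c 0 3 = 0 := by
    linear_combination (1 / 2) * E (-1) 1 0
  have h15 : -7 * a 0 3 + 7 * a 0 2 - 7 * a 0 1 + 7 * a 0 0 - 22 * b 0 3 + 22 * b 0 2 - 22 * b 0 1 + 22 * b
    0 0 + 458 * c 0 3 - 458 * c 0 2 + 458 * c 0 1 - 458 * c 0 0 = 0 := by
    linear_combination (1 / 3072) * E 0 (-1) 1
  have h16 : 27 * a 3 0 + 9 * a 2 1 - 9 * a 2 0 + 3 * a 1 2 - 3 * a 1 1 + 3 * a 1 0 + a 0 3 - a 0 2 + a 0 1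
    - a 0 0 + 81 * c 3 0 + 27 * c 2 1 - 27 * c 2 0 + 9 * c 1 2 - 9 * c 1 1 + 9 * c 1 0 + 3 * c 0 3
    - 3 * c 0 2 + 3 * c 0 1 - 3 * c 0 0 = 0 := by
    linear_combination (1 / 5460) * E (-3) (-1) 1
  have h17 : b 3 0 + 3 * b 2 1 - b 2 0 + 9 * b 1 2 - 3 * b 1 1 + b 1 0 + 27 * b 0 3 - 9 * b 0 2 + 3 * b 0 1
    - b 0 0 + 3 * c 3 0 + 9 * c 2 1 - 3 * c 2 0 + 27 * c 1 2 - 9 * c 1 1 + 3 * c 1 0 + 81 * c 0 3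
    - 27 * c 0 2 + 9 * c 0 1 - 3 * c 0 0 = 0 := by
    linear_combination (1 / 81000) * E (-1) (-3) 1
  have h18 : 6 * a 3 0 - 36 * a 2 1 + 216 * a 1 2 - 1296 * a 0 3 + b 3 0 - 6 * b 2 1 + 36 * b 1 2 - 216 * b
    0 3 + 21 * c 3 0 - 126 * c 2 1 + 756 * c 1 2 - 4536 * c 0 3 = 0 := by
    linear_combination (1 / 4662) * E (-1) 6 0
  have h19 : 27 * a 3 0 - 9 * a 2 1 - 9 * a 2 0 + 3 * a 1 2 + 3 * a 1 1 + 3 * a 1 0 - a 0 3 - a 0 2 - a 0 1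
    - a 0 0 + 81 * c 3 0 - 27 * c 2 1 - 27 * c 2 0 + 9 * c 1 2 + 9 * c 1 1 + 9 * c 1 0 - 3 * c 0 3
    - 3 * c 0 2 - 3 * c 0 1 - 3 * c 0 0 = 0 := by
    linear_combination (1 / 8400) * E (-3) 1 1
  have h20 : -b 3 0 + 3 * b 2 1 - b 2 0 - 9 * b 1 2 + 3 * b 1 1 - b 1 0 + 27 * b 0 3 - 9 * b 0 2 + 3 * b 0
    1 - b 0 0 - 3 * c 3 0 + 9 * c 2 1 - 3 * c 2 0 - 27 * c 1 2 + 9 * c 1 1 - 3 * c 1 0 + 81 * c 0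
    3 - 27 * c 0 2 + 9 * c 0 1 - 3 * c 0 0 = 0 := by
    linear_combination (1 / 194400) * E (-1) 3 (-1)
  have h21 : 179 * a 0 3 + 179 * a 0 2 + 179 * a 0 1 + 179 * a 0 0 + 160 * b 0 3 + 160 * b 0 2 + 160 * b 0
    1 + 160 * b 0 0 + 896 * c 0 3 + 896 * c 0 2 + 896 * c 0 1 + 896 * c 0 0 = 0 := by
    linear_combination (1 / 3072) * E 0 (-1) (-1)
  have h22 : 64 * a 3 0 + 16 * a 2 1 - 16 * a 2 0 + 4 * a 1 2 - 4 * a 1 1 + 4 * a 1 0 + a 0 3 - a 0 2 + a 0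
    1 - a 0 0 + 256 * c 3 0 + 64 * c 2 1 - 64 * c 2 0 + 16 * c 1 2 - 16 * c 1 1 + 16 * c 1 0 + 4 *
    c 0 3 - 4 * c 0 2 + 4 * c 0 1 - 4 * c 0 0 = 0 := by
    linear_combination (1 / 8192) * E (-4) (-1) 1
  have h23 : 27 * a 3 0 + 18 * a 2 1 - 9 * a 2 0 + 12 * a 1 2 - 6 * a 1 1 + 3 * a 1 0 + 8 * a 0 3 - 4 * a 0
    2 + 2 * a 0 1 - a 0 0 + 81 * c 3 0 + 54 * c 2 1 - 27 * c 2 0 + 36 * c 1 2 - 18 * c 1 1 + 9 * c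
    1 0 + 24 * c 0 3 - 12 * c 0 2 + 6 * c 0 1 - 3 * c 0 0 = 0 := by
    linear_combination (1 / 1428) * E (-3) (-2) 1
  have h24 : -64 * a 3 0 - 16 * a 2 1 - 16 * a 2 0 - 4 * a 1 2 - 4 * a 1 1 - 4 * a 1 0 - a 0 3 - a 0 2 - a
    0 1 - a 0 0 + 256 * c 3 0 + 64 * c 2 1 + 64 * c 2 0 + 16 * c 1 2 + 16 * c 1 1 + 16 * c 1 0 + 4
    * c 0 3 + 4 * c 0 2 + 4 * c 0 1 + 4 * c 0 0 = 0 := by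
    linear_combination (1 / 1318912) * E (-4) (-1) (-1)
  have h25 : -64 * a 3 0 + 16 * a 2 1 - 16 * a 2 0 - 4 * a 1 2 + 4 * a 1 1 - 4 * a 1 0 + a 0 3 - a 0 2 + a
    0 1 - a 0 0 + 256 * c 3 0 - 64 * c 2 1 + 64 * c 2 0 + 16 * c 1 2 - 16 * c 1 1 + 16 * c 1 0 - 4
    * c 0 3 + 4 * c 0 2 - 4 * c 0 1 + 4 * c 0 0 = 0 := by
    linear_combination (1 / 315392) * E (-4) 1 (-1)
  have h26 : 183 * a 3 0 + 549 * a 2 1 + 1647 * a 1 2 + 4941 * a 0 3 + 59 * b 3 0 + 177 * b 2 1 + 531 * b 1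
    2 + 1593 * b 0 3 + 285 * c 3 0 + 855 * c 2 1 + 2565 * c 1 2 + 7695 * c 0 3 = 0 := by
    linear_combination (1 / 90) * E (-1) (-3) 0
  have h27 : 339 * a 3 0 + 339 * a 2 0 + 339 * a 1 0 + 339 * a 0 0 + 460 * b 3 0 + 460 * b 2 0 + 460 * b 1
    0 + 460 * b 0 0 + 1821 * c 3 0 + 1821 * c 2 0 + 1821 * c 1 0 + 1821 * c 0 0 = 0 := by
    linear_combination (1 / 1296) * E (-1) 0 (-1)
  have h28 : 86 * a 3 0 - 172 * a 2 1 + 344 * a 1 2 - 688 * a 0 3 - 37 * b 3 0 + 74 * b 2 1 - 148 * b 1 2 +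
    296 * b 0 3 + 135 * c 3 0 - 270 * c 2 1 + 540 * c 1 2 - 1080 * c 0 3 = 0 := by
    linear_combination (1 / 10) * E (-1) 2 0
  have h29 : -3824 * a 3 0 + 1912 * a 2 1 - 956 * a 1 2 + 478 * a 0 3 - 608 * b 3 0 + 304 * b 2 1 - 152 * b
    1 2 + 76 * b 0 3 - 360 * c 3 0 + 180 * c 2 1 - 90 * c 1 2 + 45 * c 0 3 = 0 := by
    linear_combination (1 / 8) * E (-2) 1 0
  clear E
  refine ⟨?_, ?_, ?_, ?_, ?_, ?_, ?_, ?_, ?_, ?_, ?_, ?_, ?_, ?_, ?_, ?_, ?_, ?_, ?_, ?_, ?_, ?_, ?_,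
    ?_, ?_, ?_, ?_, ?_, ?_, ?_⟩
  · linear_combination 80111/37616 * h0 + 97721/1880800 * h1 + 890341/2106496 * h2 + 2433/150464 * h3 +
      1012037/4739616 * h4 + 1505/42318 * h5 + 303251/67708800 * h6 + 181589/16927200 * h7 -
      45131/3761600 * h8 - 2081/940400 * h9 - 2923/112848 * h10 + 1925/150464 * h11 +
      586501/19748400 * h12 - 14757/94040 * h14 - 385/300928 * h15 - 376993/526624 * h16 +
      208171/65169720 * h18 - 30367/526624 * h19 - 175/150464 * h21 - 6615/601856 * h22 +
      25389/75232 * h23 - 109737/1053248 * h24 - 432333/4212992 * h25 - 4927/59245200 * h26 +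
      4207/2821200 * h28 - 21029/8689296 * h29
  · linear_combination 1067819/225696 * h0 + 2643017/22569600 * h1 + 2912995/3159744 * h2 + 3053/75232 * h3 +
      6438211/12638976 * h4 + 126889/1805568 * h5 + 240617/22569600 * h6 + 236641/11284800 * h7 -
      594901/22569600 * h8 - 8093/2821200 * h9 - 527539/9479232 * h10 + 51755/1805568 * h11 +
      336729/5266240 * h12 - 129967/376160 * h14 - 10351/3611136 * h15 - 1431667/902784 * h16 +
      10253/1504640 * h18 - 102221/902784 * h19 - 4705/1805568 * h21 - 59283/2407424 * h22 +
      681661/902784 * h23 - 149475/601856 * h24 - 589431/2407424 * h25 - 499/2256960 * h26 +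
      53989/13541760 * h28 - 6301/1354176 * h29
  · linear_combination 53892725/5021736 * h0 + 37666303/100434720 * h1 - 181107/2106496 * h2 - 168737/2510868 * h3
      + 137116529/93739072 * h4 - 9420517/602608320 * h5 + 2856079/1205216640 * h6 -
      745859/66956480 * h7 - 10101221/100434720 * h8 - 1946209/50217360 * h9 - 10660357/70304304 *
      h10 + 1398701/13391296 * h11 + 178136669/1757607600 * h12 + 23/17088 * h13 - 343619/836956 *
      h14 - 863671/80347776 * h15 - 295094623/140608608 * h16 + 161/2136 * h17 +
      127300487/4640084064 * h18 + 104582447/140608608 * h19 + 161/2136 * h20 - 375907/40173888 *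
      h21 - 2645919/53565184 * h22 + 9768113/6695648 * h23 - 69751827/93739072 * h24 -
      276361389/374956288 * h25 - 8460133/5272822800 * h26 + 7/42720 * h27 - 14005639/502173600 *
      h28 - 6645041/773347344 * h29
  · linear_combination -72647/225696 * h0 - 12097/7523200 * h1 - 26987/300928 * h2 + 2945/300928 * h3 +
      341447/5416704 * h4 - 151093/5416704 * h5 + 35501/33854400 * h6 - 311479/33854400 * h7 +
      1947/940400 * h8 + 10041/1880800 * h9 + 45877/9479232 * h10 - 495/601856 * h11 -
      32393/15798720 * h12 + 789/188080 * h14 + 99/1203712 * h15 + 194877/2106496 * h16 -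
      864271/1042715520 * h18 + 92579/2106496 * h19 + 45/601856 * h21 + 1701/2407424 * h22 -
      7469/300928 * h23 - 128157/4212992 * h24 - 514329/16851968 * h25 + 271/9479232 * h26 +
      20237/13541760 * h28 + 20387/104271552 * h29
  · linear_combination -22513351/677088 * h0 - 26154179/13541760 * h1 + 6479471/2708352 * h2 - 354541/902784 * h3 -
      101057545/16250112 * h4 - 19071997/16250112 * h5 - 247063/4062528 * h6 - 6122807/20312640 *
      h7 + 3256619/6770880 * h8 + 158719/846360 * h9 + 575885/1354176 * h10 - 2589601/5416704 *
      h11 - 6064723/33854400 * h12 + 23863/282120 * h14 + 529205/10833408 * h15 + 20701481/2708352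
      * h16 - 56994997/446878080 * h18 - 66950399/18958464 * h19 + 237983/5416704 * h21 +
      967555/2407424 * h22 - 16220183/2708352 * h23 + 12817761/4212992 * h24 + 7444151/2407424 *
      h25 + 1259161/101563200 * h26 + 14007791/67708800 * h28 + 274063/14895936 * h29
  · linear_combination 542969/37616 * h0 + 7740061/11284800 * h1 - 3808575/1053248 * h2 + 20603/225696 * h3 +
      4391795/2106496 * h4 + 1611941/2708352 * h5 - 2447971/16927200 * h6 + 518401/1880800 * h7 -
      1932163/11284800 * h8 - 482741/5642400 * h9 - 104407/526624 * h10 + 53337/300928 * h11 +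
      1154983/13165600 * h12 - 5119/37616 * h14 - 33883/1805568 * h15 - 736207/3159744 * h16 +
      709495/14895936 * h18 + 7547759/3159744 * h19 - 14119/902784 * h21 - 17091/1203712 * h22 +
      198865/150464 * h23 - 2512215/2106496 * h24 - 10031769/8425984 * h25 - 410423/118490400 *
      h26 - 286763/3761600 * h28 - 49355/5792864 * h29
  · linear_combination 1309/2351 * h0 - 2389/705300 * h1 + 1181/28212 * h2 + 11/4702 * h3 + 1849/169272 * h4 +
      325/169272 * h5 + 1489/1057950 * h6 + 1699/1057950 * h7 + 947/705300 * h8 + 332/176325 * h9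
      - 353/32914 * h10 - 55/56424 * h11 + 5721/822850 * h12 - 464/11755 * h14 + 11/112848 * h15 -
      937/28212 * h16 + 193/2962260 * h18 - 157/9404 * h19 + 5/56424 * h21 + 63/75232 * h22 +
      215/28212 * h23 - 81/18808 * h24 - 333/75232 * h25 + 2689/7405650 * h26 + 339/235100 * h28 -
      17/32914 * h29
  · linear_combination -3719/2351 * h0 - 64351/235100 * h1 + 735573/65828 * h2 - 833/9404 * h3 - 91985/131656 * h4
      - 643/18808 * h5 - 1123/117550 * h6 + 487/117550 * h7 + 3682/58775 * h8 + 583/58775 * h9 +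
      2161/98742 * h10 - 1265/18808 * h11 + 23291/822850 * h12 - 3804/11755 * h14 + 253/37616 *
      h15 - 621057/65828 * h16 - 64019/10861620 * h18 - 282719/65828 * h19 + 115/18808 * h21 +
      4347/75232 * h22 + 23753/9404 * h23 + 45513/131656 * h24 + 177705/526624 * h25 +
      5423/2468550 * h26 + 32557/705300 * h28 - 1093/1086162 * h29
  · linear_combination -966952/7053 * h0 - 54833/7053 * h1 + 1262929/49371 * h2 - 14775/9404 * h3 - 420743/16457 *
      h4 - 7168/2351 * h5 - 3221/11755 * h6 - 13444/11755 * h7 + 54601/28212 * h8 + 5401/7053 * h9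
      + 88288/49371 * h10 - 13750/7053 * h11 - 895031/1234275 * h12 + 2996/11755 * h14 + 1375/7053
      * h15 + 797134/49371 * h16 - 4129508/8146215 * h18 - 347314/16457 * h19 + 1250/7053 * h21 +
      411/2351 * h22 - 132302/7053 * h23 + 414747/32914 * h24 + 413925/32914 * h25 +
      178132/3702825 * h26 + 151148/176325 * h28 + 40856/543081 * h29
  · linear_combination -25/7 * h2 - 25/42 * h4 + 25/6 * h5 - 1/3 * h6 + 4/3 * h7
  · linear_combination h0 - 3/112 * h2 + 1/168 * h4 + 1/24 * h5 + 1/240 * h6 + 1/60 * h7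
  · linear_combination -278239/112848 * h0 + 31967/376160 * h1 - 4784275/2106496 * h2 - 999/150464 * h3 +
      136219/1184904 * h4 + 49021/677088 * h5 - 9989/2708352 * h6 + 58541/3385440 * h7 -
      3775/150464 * h8 - 3869/188080 * h9 + 43333/789936 * h10 + 3355/150464 * h11 -
      473299/6582800 * h12 + 49647/94040 * h14 - 671/300928 * h15 + 978445/526624 * h16 +
      869573/130339440 * h18 + 450323/526624 * h19 - 305/150464 * h21 - 11529/601856 * h22 -
      36625/75232 * h23 - 65511/1053248 * h24 - 250515/4212992 * h25 - 101821/59245200 * h26 -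
      25321/705300 * h28 + 41537/8689296 * h29
  · linear_combination -183805/4702 * h0 - 307497/235100 * h1 - 1301817/263312 * h2 + 12301/18808 * h3 -
      1925257/394968 * h4 - 43859/56424 * h5 - 114229/2821200 * h6 - 161201/705300 * h7 +
      146757/470200 * h8 + 10227/117550 * h9 + 2687/4702 * h10 - 6105/18808 * h11 - 365973/822850
      * h12 + 50679/23510 * h14 + 1221/37616 * h15 + 795399/65828 * h16 - 1/2 * h17 -
      302311/3620540 * h18 - 27423/65828 * h19 - 1/2 * h20 + 555/18808 * h21 + 20979/75232 * h22 -
      60771/9404 * h23 + 319005/131656 * h24 + 1255041/526624 * h25 + 1551/411425 * h26 +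
      9443/235100 * h28 + 12961/362054 * h29
  · linear_combination -176343/75232 * h0 + 773237/4513920 * h1 - 11137033/3159744 * h2 + 237/75232 * h3 +
      12913513/37916928 * h4 + 439963/5416704 * h5 - 104153/13541760 * h6 + 16171/1354176 * h7 -
      215953/4513920 * h8 - 18617/564240 * h9 + 346765/9479232 * h10 + 79915/1805568 * h11 -
      5617321/78993600 * h12 + 201641/376160 * h14 - 15983/3611136 * h15 + 2433517/902784 * h16 +
      4137691/347571840 * h18 + 1267411/902784 * h19 - 7265/1805568 * h21 - 91539/2407424 * h22 -
      185633/300928 * h23 - 108003/601856 * h24 - 418935/2407424 * h25 - 54307/26331200 * h26 -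
      3172967/67708800 * h28 + 451751/104271552 * h29
  · linear_combination -78710273/5021736 * h0 + 70059121/167391200 * h1 - 8328771/2106496 * h2 - 760825/3347824 *
      h3 + 208609633/843651648 * h4 + 4404667/66956480 * h5 - 770983/2008694400 * h6 -
      10124747/3013041600 * h7 - 72782659/502173600 * h8 - 24408743/251086800 * h9 +
      4793265/23434768 * h10 + 1579941/13391296 * h11 - 24175111/70304304 * h12 - 13/17088 * h13 +
      9850751/4184780 * h14 - 803143/80347776 * h15 + 298575269/140608608 * h16 - 91/2136 * h17 +
      905505991/23200420320 * h18 + 249098123/140608608 * h19 + 207/712 * h20 - 463807/40173888 *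
      h21 + 1860729/53565184 * h22 - 876979/6695648 * h23 - 15716823/93739072 * h24 -
      24554133/374956288 * h25 - 8330993/1054564560 * h26 + 9/14240 * h27 - 5438349/33478240 * h28
      + 5749369/257782448 * h29
  · linear_combination -18848724/209239 * h0 - 348820327/83695600 * h1 + 2861763/131656 * h2 - 2822377/3347824 * h3
      - 1998632147/140608608 * h4 - 18467339/6695648 * h5 + 1599263/83695600 * h6 -
      266914771/251086800 * h7 + 5338041/5230975 * h8 + 21221607/41847800 * h9 + 13980299/11717384
      * h10 - 7085325/6695648 * h11 - 170646603/292934600 * h12 - 9/1424 * h13 + 4804407/4184780 *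
      h14 + 1501701/13391296 * h15 + 52195929/23434768 * h16 + 13/89 * h17 - 52289293/184130320 *
      h18 - 328598073/23434768 * h19 + 13/89 * h20 + 624885/6695648 * h21 + 1911519/26782592 * h22
      - 27381621/3347824 * h23 + 335601495/46869536 * h24 + 1340494461/187478144 * h25 +
      5981547/292934600 * h26 + 1/712 * h27 + 36973673/83695600 * h28 + 7207591/128891224 * h29
  · linear_combination 82769/225696 * h0 + 326837/22569600 * h1 - 8368495/6319488 * h2 - 399/300928 * h3 +
      723721/37916928 * h4 + 100435/5416704 * h5 - 2747/33854400 * h6 + 182593/33854400 * h7 -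
      1519/352650 * h8 - 20341/5642400 * h9 - 73075/9479232 * h10 + 6875/1805568 * h11 +
      200923/78993600 * h12 - 1563/188080 * h14 - 1375/3611136 * h15 + 7901087/6319488 * h16 -
      284183/1042715520 * h18 + 2885377/6319488 * h19 - 625/1805568 * h21 - 7875/2407424 * h22 -
      356015/902784 * h23 - 41973/4212992 * h24 - 160017/16851968 * h25 + 49439/236980800 * h26 -
      61639/67708800 * h28 - 24725/104271552 * h29
  · linear_combination 5019745/677088 * h0 + 8259109/13541760 * h1 - 6981775/18958464 * h2 + 26889/300928 * h3 +
      74546947/37916928 * h4 + 1723081/5416704 * h5 + 43367/6770880 * h6 + 727547/6770880 * h7 -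
      1216597/6770880 * h8 - 10315/169272 * h9 - 720173/9479232 * h10 + 883319/5416704 * h11 +
      111019/9479232 * h12 + 69871/282120 * h14 - 165379/10833408 * h15 - 59786569/18958464 * h16
      + 123304277/3128146560 * h18 + 21616489/18958464 * h19 - 77737/5416704 * h21 - 57541/2407424
      * h22 + 5863825/2708352 * h23 - 4137111/4212992 * h24 - 16490903/16851968 * h25 -
      869413/142188480 * h26 - 1074277/13541760 * h28 - 273775/104271552 * h29
  · linear_combination 19369/37616 * h0 + 9636061/11284800 * h1 + 27585475/3159744 * h2 + 41651/75232 * h3 +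
      43752955/18958464 * h4 - 2279659/2708352 * h5 + 1376309/16927200 * h6 - 4665671/16927200 *
      h7 - 911381/3761600 * h8 + 32673/1880800 * h9 + 36793/526624 * h10 + 182011/902784 * h11 -
      1133417/13165600 * h12 + 32001/37616 * h14 - 12761/601856 * h15 - 12536469/1053248 * h16 +
      1598875/34757184 * h18 - 4299041/3159744 * h19 - 5373/300928 * h21 - 42291/1203712 * h22 +
      2391395/451392 * h23 - 2285415/2106496 * h24 - 9099369/8425984 * h25 - 70763/5642400 * h26 -
      422363/3761600 * h28 + 3635/827552 * h29
  · linear_combination 1/4 * h1 + 75/28 * h2 + 25/56 * h4 - 25/8 * h5 + 1/4 * h6 - h7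
  · linear_combination 1/112 * h2 - 1/504 * h4 - 1/72 * h5 - 1/720 * h6 - 1/180 * h7
  · linear_combination -237967/84636 * h0 - 441053/2821200 * h1 + 22949/65828 * h2 - 145/4702 * h3 -
      7299695/14218848 * h4 - 190973/2031264 * h5 - 139147/25390800 * h6 - 303161/12695400 * h7 +
      110149/2821200 * h8 + 5567/352650 * h9 + 43339/1184904 * h10 - 8855/225696 * h11 -
      460693/29622600 * h12 + 132/11755 * h14 + 1771/451392 * h15 + 382813/789936 * h16 -
      1360321/130339440 * h18 - 92303/263312 * h19 + 805/225696 * h21 + 10143/300928 * h22 -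
      50021/112848 * h23 + 134409/526624 * h24 + 527493/2106496 * h25 + 3173/3291400 * h26 +
      143263/8463600 * h28 + 20561/13033944 * h29
  · linear_combination 80111/37616 * h0 + 97721/1880800 * h1 + 890341/2106496 * h2 + 2433/150464 * h3 +
      315403/1579872 * h4 + 8371/169272 * h5 - 449069/67708800 * h6 + 123223/5642400 * h7 -
      45131/3761600 * h8 - 2081/940400 * h9 - 2923/112848 * h10 + 1925/150464 * h11 +
      586501/19748400 * h12 - 14757/94040 * h14 - 385/300928 * h15 - 376993/526624 * h16 +
      208171/65169720 * h18 - 30367/526624 * h19 - 175/150464 * h21 - 6615/601856 * h22 +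
      25389/75232 * h23 - 109737/1053248 * h24 - 432333/4212992 * h25 - 4927/59245200 * h26 +
      4207/2821200 * h28 - 21029/8689296 * h29
  · linear_combination -3719/28212 * h0 - 64351/2821200 * h1 + 697957/789936 * h2 - 833/112848 * h3 -
      148409/1579872 * h4 - 643/225696 * h5 - 1123/1410600 * h6 + 487/1410600 * h7 + 1841/352650 *
      h8 + 583/705300 * h9 + 2161/1184904 * h10 - 1265/225696 * h11 + 23291/9874200 * h12 -
      317/11755 * h14 + 253/451392 * h15 - 602249/789936 * h16 - 64019/130339440 * h18 -
      263911/789936 * h19 + 115/225696 * h21 + 1449/300928 * h22 + 23753/112848 * h23 +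
      24575/526624 * h24 + 96851/2106496 * h25 + 5423/29622600 * h26 + 32557/8463600 * h28 -
      1093/13033944 * h29
  · linear_combination -865669/225696 * h0 - 2819021/7523200 * h1 + 8558087/3159744 * h2 - 13387/225696 * h3 -
      41967655/37916928 * h4 - 485461/5416704 * h5 - 445229/67708800 * h6 - 1703677/33854400 * h7
      + 2166499/22569600 * h8 + 127847/2821200 * h9 + 529885/9479232 * h10 - 170885/1805568 * h11
      + 1551719/78993600 * h12 - 127439/376160 * h14 + 34177/3611136 * h15 - 4749365/6319488 * h16
      - 26054527/1042715520 * h18 - 9472651/6319488 * h19 + 15535/1805568 * h21 - 105187/2407424 *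
      h22 - 328819/902784 * h23 + 2376091/4212992 * h24 + 9007695/16851968 * h25 +
      676357/236980800 * h26 + 3968713/67708800 * h28 - 457/104271552 * h29
  · linear_combination 53892725/5021736 * h0 + 37666303/100434720 * h1 - 952235/2106496 * h2 - 168737/2510868 * h3
      + 1255809617/843651648 * h4 + 33361467/66956480 * h5 + 1509997/401738880 * h6 +
      97069813/602608320 * h7 - 10101221/100434720 * h8 - 1946209/50217360 * h9 -
      10660357/70304304 * h10 + 1398701/13391296 * h11 + 178136669/1757607600 * h12 + 23/17088 *
      h13 - 343619/836956 * h14 - 863671/80347776 * h15 - 295094623/140608608 * h16 + 161/2136 *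
      h17 + 127300487/4640084064 * h18 + 104582447/140608608 * h19 + 161/2136 * h20 -
      375907/40173888 * h21 - 2645919/53565184 * h22 + 9768113/6695648 * h23 - 69751827/93739072 *
      h24 - 276361389/374956288 * h25 - 8460133/5272822800 * h26 + 7/42720 * h27 -
      14005639/502173600 * h28 - 6645041/773347344 * h29
  · linear_combination -1309/7053 * h0 + 2389/2115900 * h1 + 12925/84636 * h2 - 11/14106 * h3 - 1849/507816 * h4 -
      325/507816 * h5 - 1489/3173850 * h6 - 1699/3173850 * h7 - 947/2115900 * h8 - 332/528975 * h9
      + 353/98742 * h10 + 55/169272 * h11 - 1907/822850 * h12 + 464/35265 * h14 - 11/338544 * h15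
      - 13169/84636 * h16 - 193/8886780 * h18 - 4231/84636 * h19 - 5/169272 * h21 - 21/75232 * h22
      + 4487/84636 * h23 + 27/18808 * h24 + 111/75232 * h25 - 2689/22216950 * h26 - 113/235100 *
      h28 + 17/98742 * h29
  · linear_combination -42895/225696 * h0 + 478517/22569600 * h1 - 749657/902784 * h2 + 15499/902784 * h3 +
      76463/5416704 * h4 - 135661/5416704 * h5 + 62453/33854400 * h6 - 323167/33854400 * h7 -
      8887/2821200 * h8 + 25459/5642400 * h9 + 28589/9479232 * h10 + 8635/1805568 * h11 -
      348293/78993600 * h12 + 5861/188080 * h14 - 1727/3611136 * h15 + 4951231/6319488 * h16 -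
      117373/347571840 * h18 + 1937633/6319488 * h19 - 785/1805568 * h21 - 9891/2407424 * h22 -
      212431/902784 * h23 - 23829/4212992 * h24 - 85425/16851968 * h25 - 12203/78993600 * h26 -
      159271/67708800 * h28 + 29131/104271552 * h29
  · linear_combination 8161345/677088 * h0 + 13353811/22569600 * h1 - 8592279/2106496 * h2 + 98267/902784 * h3 +
      236026505/113750784 * h4 + 3397979/16250112 * h5 + 2857337/101563200 * h6 +
      8209877/101563200 * h7 - 1675699/11284800 * h8 - 30679/470200 * h9 - 1567373/9479232 * h10 +
      279773/1805568 * h11 + 660235/9479232 * h12 - 7643/94040 * h14 - 52193/3611136 * h15 +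
      4653277/6319488 * h16 + 41667559/1042715520 * h18 + 15103363/6319488 * h19 - 8193/601856 *
      h21 - 40741/2407424 * h22 + 758075/902784 * h23 - 4288311/4212992 * h24 - 17112503/16851968
      * h25 - 6971/2256960 * h26 - 911557/13541760 * h28 - 103225/14895936 * h29
  · linear_combination 542969/37616 * h0 + 7740061/11284800 * h1 - 3808575/1053248 * h2 + 20603/225696 * h3 +
      46108955/18958464 * h4 + 223847/902784 * h5 + 187103/5642400 * h6 + 1656329/16927200 * h7 -
      1932163/11284800 * h8 - 482741/5642400 * h9 - 104407/526624 * h10 + 53337/300928 * h11 +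
      1154983/13165600 * h12 - 5119/37616 * h14 - 33883/1805568 * h15 - 736207/3159744 * h16 +
      709495/14895936 * h18 + 7547759/3159744 * h19 - 14119/902784 * h21 - 17091/1203712 * h22 +
      198865/150464 * h23 - 2512215/2106496 * h24 - 10031769/8425984 * h25 - 410423/118490400 *
      h26 - 286763/3761600 * h28 - 49355/5792864 * h29

lemma Q1_no : ¬ ∃ a b c : MvPolynomial (Fin 3) ℂ,
      ¬ (a = 0 ∧ b = 0 ∧ c = 0) ∧
      a.IsHomogeneous 3 ∧ b.IsHomogeneous 3 ∧ c.IsHomogeneous 3 ∧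
      a * pderiv 0 Q1 + b * pderiv 1 Q1 + c * pderiv 2 Q1 = 0 := by
  rintro ⟨a, b, c, h0, ha, hb, hc, h⟩
  obtain ⟨a', ha'⟩ := homog_eval ha
  obtain ⟨b', hb'⟩ := homog_eval hb
  obtain ⟨c', hc'⟩ := homog_eval hc
  have L := Q1_lin a' b' c' (by
    intro x y z
    have e := congrArg (eval ![x, y, z]) h
    rw [Q1_d0, Q1_d1, Q1_d2] at e
    simp only [map_add, map_mul, ha', hb', hc'] at e
    simp [Finset.sum_range_succ] at e
    linear_combination e)
  obtain ⟨e0, e1, e2, e3, e4, e5, e6, e7, e8, e9, e10, e11, e12, e13, e14, e15, e16, e17, e18, e19, e20,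
    e21, e22, e23, e24, e25, e26, e27, e28, e29⟩ := L
  apply h0
  refine ⟨eq_zero_of_eval ?_, eq_zero_of_eval ?_, eq_zero_of_eval ?_⟩
  · intro x y z
    rw [ha']
    simp [Finset.sum_range_succ, e0, e1, e2, e3, e4, e5, e6, e7, e8, e9]
  · intro x y z
    rw [hb']
    simp [Finset.sum_range_succ, e10, e11, e12, e13, e14, e15, e16, e17, e18, e19]
  · intro x y z
    rw [hc']
    simp [Finset.sum_range_succ, e20, e21, e22, e23, e24, e25, e26, e27, e28, e29]

set_option maxHeartbeats 4000000 in
lemma Q1_ex : ∃ a b c : MvPolynomial (Fin 3) ℂ,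
      ¬ (a = 0 ∧ b = 0 ∧ c = 0) ∧
      a.IsHomogeneous 4 ∧ b.IsHomogeneous 4 ∧ c.IsHomogeneous 4 ∧
      a * pderiv 0 Q1 + b * pderiv 1 Q1 + c * pderiv 2 Q1 = 0 := by
  have hm (i j k : ℕ) (t : ℂ) (hs : i + j + k = 4) :
      (C t * (X 0 ^ i * X 1 ^ j * X 2 ^ k) : MvPolynomial (Fin 3) ℂ).IsHomogeneous 4 := by
    have := (isHomogeneous_C (Fin 3) t).mul ((((isHomogeneous_X_pow (R := ℂ) (0 : Fin 3) i).mul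
      (isHomogeneous_X_pow (1 : Fin 3) j)).mul (isHomogeneous_X_pow (2 : Fin 3) k)))
    rwa [hs, zero_add] at this
  refine ⟨C (-162) * (X 0 ^ 4 * X 1 ^ 0 * X 2 ^ 0) + C (-99) * (X 0 ^ 3 * X 1 ^ 1 * X 2 ^ 0) + C (3828)
    * (X 0 ^ 3 * X 1 ^ 0 * X 2 ^ 1) + C (777) * (X 0 ^ 2 * X 1 ^ 2 * X 2 ^ 0) + C (10815) * (X 0 ^
    2 * X 1 ^ 1 * X 2 ^ 1) + C (11214) * (X 0 ^ 2 * X 1 ^ 0 * X 2 ^ 2) + C (100) * (X 0 ^ 1 * X 1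
    ^ 3 * X 2 ^ 0) + C (2452) * (X 0 ^ 1 * X 1 ^ 2 * X 2 ^ 1) + C (43008) * (X 0 ^ 1 * X 1 ^ 1 * X
    2 ^ 2) + C (-134400) * (X 0 ^ 1 * X 1 ^ 0 * X 2 ^ 3) + C (384) * (X 0 ^ 0 * X 1 ^ 2 * X 2 ^ 2)
    + C (28800) * (X 0 ^ 0 * X 1 ^ 1 * X 2 ^ 3) + C (-403200) * (X 0 ^ 0 * X 1 ^ 0 * X 2 ^ 4),
    C (-1008) * (X 0 ^ 4 * X 1 ^ 0 * X 2 ^ 0) + C (-1626) * (X 0 ^ 3 * X 1 ^ 1 * X 2 ^ 0) + C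
    (-1152) * (X 0 ^ 3 * X 1 ^ 0 * X 2 ^ 1) + C (-1267) * (X 0 ^ 2 * X 1 ^ 2 * X 2 ^ 0) + C
    (-9012) * (X 0 ^ 2 * X 1 ^ 1 * X 2 ^ 1) + C (37296) * (X 0 ^ 2 * X 1 ^ 0 * X 2 ^ 2) + C (-687)
    * (X 0 ^ 1 * X 1 ^ 3 * X 2 ^ 0) + C (-7737) * (X 0 ^ 1 * X 1 ^ 2 * X 2 ^ 1) + C (22830) * (X 0
    ^ 1 * X 1 ^ 1 * X 2 ^ 2) + C (201600) * (X 0 ^ 1 * X 1 ^ 0 * X 2 ^ 3) + C (-60) * (X 0 ^ 0 * X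
    1 ^ 4 * X 2 ^ 0) + C (-2188) * (X 0 ^ 0 * X 1 ^ 3 * X 2 ^ 1) + C (-8096) * (X 0 ^ 0 * X 1 ^ 2
    * X 2 ^ 2) + C (112800) * (X 0 ^ 0 * X 1 ^ 1 * X 2 ^ 3) + C (302400) * (X 0 ^ 0 * X 1 ^ 0 * X
    2 ^ 4),
    C (336) * (X 0 ^ 4 * X 1 ^ 0 * X 2 ^ 0) + C (696) * (X 0 ^ 3 * X 1 ^ 1 * X 2 ^ 0) + C (846) *
    (X 0 ^ 3 * X 1 ^ 0 * X 2 ^ 1) + C (8) * (X 0 ^ 2 * X 1 ^ 2 * X 2 ^ 0) + C (2589) * (X 0 ^ 2 *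
    X 1 ^ 1 * X 2 ^ 1) + C (-9948) * (X 0 ^ 2 * X 1 ^ 0 * X 2 ^ 2) + C (801) * (X 0 ^ 1 * X 1 ^ 2
    * X 2 ^ 1) + C (1479) * (X 0 ^ 1 * X 1 ^ 1 * X 2 ^ 2) + C (-30114) * (X 0 ^ 1 * X 1 ^ 0 * X 2
    ^ 3) + C (100) * (X 0 ^ 0 * X 1 ^ 3 * X 2 ^ 1) + C (2324) * (X 0 ^ 0 * X 1 ^ 2 * X 2 ^ 2), ?_, ?_, ?_, ?_, ?_⟩
  · rintro ⟨h, -, -⟩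
    have e := congrArg (eval ![1, 0, 0]) h
    simp at e
    try norm_num at e
  · repeat' apply IsHomogeneous.add
    all_goals exact hm _ _ _ _ rfl
  · repeat' apply IsHomogeneous.add
    all_goals exact hm _ _ _ _ rfl
  · repeat' apply IsHomogeneous.add
    all_goals exact hm _ _ _ _ rfl
  · rw [Q1_d0, Q1_d1, Q1_d2]
    simp only [map_neg, map_ofNat, map_one]
    ring

set_option maxHeartbeats 4000000 in
lemma Q2_d0 : pderiv 0 Q2 =
    (2 * X 0) * (X 0 + 4 * X 2) * X 0 * (X 0 - 4 * X 2) * (X 1 - 3 * X 2) * (X 1 + 3 * X 2) * (3 *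
    X 0 - 4 * X 1) + (1) * (X 0 ^ 2 + X 1 ^ 2 - 25 * X 2 ^ 2) * X 0 * (X 0 - 4 * X 2) * (X 1 - 3 *
    X 2) * (X 1 + 3 * X 2) * (3 * X 0 - 4 * X 1) + (1) * (X 0 ^ 2 + X 1 ^ 2 - 25 * X 2 ^ 2) * (X 0
    + 4 * X 2) * (X 0 - 4 * X 2) * (X 1 - 3 * X 2) * (X 1 + 3 * X 2) * (3 * X 0 - 4 * X 1) + (1) *
    (X 0 ^ 2 + X 1 ^ 2 - 25 * X 2 ^ 2) * (X 0 + 4 * X 2) * X 0 * (X 1 - 3 * X 2) * (X 1 + 3 * X 2)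
    * (3 * X 0 - 4 * X 1) + (3) * (X 0 ^ 2 + X 1 ^ 2 - 25 * X 2 ^ 2) * (X 0 + 4 * X 2) * X 0 * (X
    0 - 4 * X 2) * (X 1 - 3 * X 2) * (X 1 + 3 * X 2) := by
  obtain ⟨e3, e4, e6, e21, e25⟩ := pderiv_nums 0
  simp only [Q2, Derivation.leibniz, Derivation.leibniz_pow, map_add, map_sub, pderiv_X, e3, e4, e6, e21, e25,
    smul_eq_mul]
  simp
  ring

set_option maxHeartbeats 4000000 in
lemma Q2_d1 : pderiv 1 Q2 =
    (2 * X 1) * (X 0 + 4 * X 2) * X 0 * (X 0 - 4 * X 2) * (X 1 - 3 * X 2) * (X 1 + 3 * X 2) * (3 *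
    X 0 - 4 * X 1) + (1) * (X 0 ^ 2 + X 1 ^ 2 - 25 * X 2 ^ 2) * (X 0 + 4 * X 2) * X 0 * (X 0 - 4 *
    X 2) * (X 1 + 3 * X 2) * (3 * X 0 - 4 * X 1) + (1) * (X 0 ^ 2 + X 1 ^ 2 - 25 * X 2 ^ 2) * (X 0
    + 4 * X 2) * X 0 * (X 0 - 4 * X 2) * (X 1 - 3 * X 2) * (3 * X 0 - 4 * X 1) + (-4) * (X 0 ^ 2 +
    X 1 ^ 2 - 25 * X 2 ^ 2) * (X 0 + 4 * X 2) * X 0 * (X 0 - 4 * X 2) * (X 1 - 3 * X 2) * (X 1 + 3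
    * X 2) := by
  obtain ⟨e3, e4, e6, e21, e25⟩ := pderiv_nums 1
  simp only [Q2, Derivation.leibniz, Derivation.leibniz_pow, map_add, map_sub, pderiv_X, e3, e4, e6, e21, e25,
    smul_eq_mul]
  simp
  ring

set_option maxHeartbeats 4000000 in
lemma Q2_d2 : pderiv 2 Q2 =
    (-50 * X 2) * (X 0 + 4 * X 2) * X 0 * (X 0 - 4 * X 2) * (X 1 - 3 * X 2) * (X 1 + 3 * X 2) * (3
    * X 0 - 4 * X 1) + (4) * (X 0 ^ 2 + X 1 ^ 2 - 25 * X 2 ^ 2) * X 0 * (X 0 - 4 * X 2) * (X 1 - 3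
    * X 2) * (X 1 + 3 * X 2) * (3 * X 0 - 4 * X 1) + (-4) * (X 0 ^ 2 + X 1 ^ 2 - 25 * X 2 ^ 2) *
    (X 0 + 4 * X 2) * X 0 * (X 1 - 3 * X 2) * (X 1 + 3 * X 2) * (3 * X 0 - 4 * X 1) + (-3) * (X 0
    ^ 2 + X 1 ^ 2 - 25 * X 2 ^ 2) * (X 0 + 4 * X 2) * X 0 * (X 0 - 4 * X 2) * (X 1 + 3 * X 2) * (3
    * X 0 - 4 * X 1) + (3) * (X 0 ^ 2 + X 1 ^ 2 - 25 * X 2 ^ 2) * (X 0 + 4 * X 2) * X 0 * (X 0 - 4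
    * X 2) * (X 1 - 3 * X 2) * (3 * X 0 - 4 * X 1) := by
  obtain ⟨e3, e4, e6, e21, e25⟩ := pderiv_nums 2
  simp only [Q2, Derivation.leibniz, Derivation.leibniz_pow, map_add, map_sub, pderiv_X, e3, e4, e6, e21, e25,
    smul_eq_mul]
  simp
  ring

set_option maxHeartbeats 4000000 in
lemma Q2_lin (a b c : ℕ → ℕ → ℂ)
    (E : ∀ x y z : ℂ, (a 2 0 * x ^ 2 * y ^ 0 * z ^ 0 + a 1 1 * x ^ 1 * y ^ 1 * z ^ 0 + a 1 0 * x ^ 1 *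
    y ^ 0 * z ^ 1 + a 0 2 * x ^ 0 * y ^ 2 * z ^ 0 + a 0 1 * x ^ 0 * y ^ 1 * z ^ 1 + a 0 0 * x ^ 0
    * y ^ 0 * z ^ 2) * ((2 * x) * (x + 4 * z) * x * (x - 4 * z) * (y - 3 * z) * (y + 3 * z) * (3 *
    x - 4 * y) + (1) * (x ^ 2 + y ^ 2 - 25 * z ^ 2) * x * (x - 4 * z) * (y - 3 * z) * (y + 3 * z)
    * (3 * x - 4 * y) + (1) * (x ^ 2 + y ^ 2 - 25 * z ^ 2) * (x + 4 * z) * (x - 4 * z) * (y - 3 *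
    z) * (y + 3 * z) * (3 * x - 4 * y) + (1) * (x ^ 2 + y ^ 2 - 25 * z ^ 2) * (x + 4 * z) * x * (y
    - 3 * z) * (y + 3 * z) * (3 * x - 4 * y) + (3) * (x ^ 2 + y ^ 2 - 25 * z ^ 2) * (x + 4 * z) *
    x * (x - 4 * z) * (y - 3 * z) * (y + 3 * z)) + (b 2 0 * x ^ 2 * y ^ 0 * z ^ 0 + b 1 1 * x ^ 1
    * y ^ 1 * z ^ 0 + b 1 0 * x ^ 1 * y ^ 0 * z ^ 1 + b 0 2 * x ^ 0 * y ^ 2 * z ^ 0 + b 0 1 * x ^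
    0 * y ^ 1 * z ^ 1 + b 0 0 * x ^ 0 * y ^ 0 * z ^ 2) * ((2 * y) * (x + 4 * z) * x * (x - 4 * z)
    * (y - 3 * z) * (y + 3 * z) * (3 * x - 4 * y) + (1) * (x ^ 2 + y ^ 2 - 25 * z ^ 2) * (x + 4 *
    z) * x * (x - 4 * z) * (y + 3 * z) * (3 * x - 4 * y) + (1) * (x ^ 2 + y ^ 2 - 25 * z ^ 2) * (x
    + 4 * z) * x * (x - 4 * z) * (y - 3 * z) * (3 * x - 4 * y) + (-4) * (x ^ 2 + y ^ 2 - 25 * z ^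
    2) * (x + 4 * z) * x * (x - 4 * z) * (y - 3 * z) * (y + 3 * z)) + (c 2 0 * x ^ 2 * y ^ 0 * z ^
    0 + c 1 1 * x ^ 1 * y ^ 1 * z ^ 0 + c 1 0 * x ^ 1 * y ^ 0 * z ^ 1 + c 0 2 * x ^ 0 * y ^ 2 * z
    ^ 0 + c 0 1 * x ^ 0 * y ^ 1 * z ^ 1 + c 0 0 * x ^ 0 * y ^ 0 * z ^ 2) * ((-50 * z) * (x + 4 *
    z) * x * (x - 4 * z) * (y - 3 * z) * (y + 3 * z) * (3 * x - 4 * y) + (4) * (x ^ 2 + y ^ 2 - 25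
    * z ^ 2) * x * (x - 4 * z) * (y - 3 * z) * (y + 3 * z) * (3 * x - 4 * y) + (-4) * (x ^ 2 + y ^
    2 - 25 * z ^ 2) * (x + 4 * z) * x * (y - 3 * z) * (y + 3 * z) * (3 * x - 4 * y) + (-3) * (x ^
    2 + y ^ 2 - 25 * z ^ 2) * (x + 4 * z) * x * (x - 4 * z) * (y + 3 * z) * (3 * x - 4 * y) + (3)
    * (x ^ 2 + y ^ 2 - 25 * z ^ 2) * (x + 4 * z) * x * (x - 4 * z) * (y - 3 * z) * (3 * x - 4 *
    y)) = 0) :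
    a 2 0 = 0 ∧ a 1 1 = 0 ∧ a 1 0 = 0 ∧ a 0 2 = 0 ∧ a 0 1 = 0 ∧ a 0 0 = 0 ∧ b 2 0 = 0 ∧ b 1 1 = 0
    ∧ b 1 0 = 0 ∧ b 0 2 = 0 ∧ b 0 1 = 0 ∧ b 0 0 = 0 ∧ c 2 0 = 0 ∧ c 1 1 = 0 ∧ c 1 0 = 0 ∧ c 0 2 =
    0 ∧ c 0 1 = 0 ∧ c 0 0 = 0 := by
  have h0 : a 0 2 + a 0 1 + a 0 0 = 0 := by
    linear_combination (1 / 12288) * E 0 1 1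
  have h1 : a 0 2 + 2 * a 0 1 + 4 * a 0 0 = 0 := by
    linear_combination (1 / 887040) * E 0 1 2
  have h2 : a 0 2 + 3 * a 0 1 + 9 * a 0 0 = 0 := by
    linear_combination (1 / 10321920) * E 0 1 3
  have h3 : a 2 0 + a 1 1 + a 0 2 + 7 * b 2 0 + 7 * b 1 1 + 7 * b 0 2 = 0 := by
    linear_combination (1 / 2) * E (-1) (-1) 0
  have h4 : 76 * a 2 0 + 38 * a 1 1 + 19 * a 0 2 + 8 * b 2 0 + 4 * b 1 1 + 2 * b 0 2 = 0 := by
    linear_combination (1 / 16) * E 2 1 0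
  have h5 : 99 * a 2 0 + 33 * a 1 1 + 11 * a 0 2 + 63 * b 2 0 + 21 * b 1 1 + 7 * b 0 2 = 0 := by
    linear_combination (1 / 270) * E 3 1 0
  have h6 : 16 * a 2 0 - 4 * a 1 0 + a 0 0 + 64 * c 2 0 - 16 * c 1 0 + 4 * c 0 0 = 0 := by
    linear_combination (1 / 31104) * E 4 0 (-1)
  have h7 : 25 * a 2 0 - 5 * a 1 0 + a 0 0 + 125 * c 2 0 - 25 * c 1 0 + 5 * c 0 0 = 0 := by
    linear_combination (1 / 60750) * E (-5) 0 1
  have h8 : -16 * a 2 0 - 4 * a 1 0 - a 0 0 + 64 * c 2 0 + 16 * c 1 0 + 4 * c 0 0 = 0 := by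
    linear_combination (1 / 31104) * E (-4) 0 (-1)
  have h9 : 14 * a 2 0 + 28 * a 1 1 + 56 * a 0 2 + 13 * b 2 0 + 26 * b 1 1 + 52 * b 0 2 = 0 := by
    linear_combination (1 / 20) * E (-1) (-2) 0
  have h10 : -48 * a 2 0 - 36 * a 1 1 - 27 * a 0 2 + 64 * b 2 0 + 48 * b 1 1 + 36 * b 0 2 = 0 := by
    linear_combination (1 / 14400) * E (-4) (-3) 0
  have h11 : b 2 0 + 3 * b 1 1 - b 1 0 + 9 * b 0 2 - 3 * b 0 1 + b 0 0 + 3 * c 2 0 + 9 * c 1 1 - 3 * c 1 0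
    + 27 * c 0 2 - 9 * c 0 1 + 3 * c 0 0 = 0 := by
    linear_combination (1 / 12150) * E (-1) (-3) 1
  have h12 : b 2 0 - 3 * b 1 1 + b 1 0 + 9 * b 0 2 - 3 * b 0 1 + b 0 0 + 3 * c 2 0 - 9 * c 1 1 + 3 * c 1 0
    + 27 * c 0 2 - 9 * c 0 1 + 3 * c 0 0 = 0 := by
    linear_combination (1 / 20250) * E (-1) 3 (-1)
  have h13 : b 2 0 + 3 * b 1 1 + b 1 0 + 9 * b 0 2 + 3 * b 0 1 + b 0 0 - 3 * c 2 0 - 9 * c 1 1 - 3 * c 1 0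
    - 27 * c 0 2 - 9 * c 0 1 - 3 * c 0 0 = 0 := by
    linear_combination (1 / 12150) * E (-1) (-3) (-1)
  have h14 : 16 * a 2 0 - 4 * a 1 1 - 4 * a 1 0 + a 0 2 + a 0 1 + a 0 0 + 64 * c 2 0 - 16 * c 1 1 - 16 * c
    1 0 + 4 * c 0 2 + 4 * c 0 1 + 4 * c 0 0 = 0 := by
    linear_combination (1 / 32768) * E 4 (-1) (-1)
  have h15 : 16 * a 2 0 + 4 * a 1 1 - 4 * a 1 0 + a 0 2 - a 0 1 + a 0 0 + 64 * c 2 0 + 16 * c 1 1 - 16 * c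
    1 0 + 4 * c 0 2 - 4 * c 0 1 + 4 * c 0 0 = 0 := by
    linear_combination (1 / 16384) * E 4 1 (-1)
  have h16 : 20 * a 2 0 + 10 * a 1 0 + 5 * a 0 0 - 28 * b 2 0 - 14 * b 1 0 - 7 * b 0 0 + 296 * c 2 0 + 148
    * c 1 0 + 74 * c 0 0 = 0 := by
    linear_combination (1 / 2592) * E (-2) 0 (-1)
  have h17 : -16 * a 2 0 - 4 * a 1 1 - 4 * a 1 0 - a 0 2 - a 0 1 - a 0 0 + 64 * c 2 0 + 16 * c 1 1 + 16 * c
    1 0 + 4 * c 0 2 + 4 * c 0 1 + 4 * c 0 0 = 0 := by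
    linear_combination (1 / 16384) * E (-4) (-1) (-1)
  clear E
  refine ⟨?_, ?_, ?_, ?_, ?_, ?_, ?_, ?_, ?_, ?_, ?_, ?_, ?_, ?_, ?_, ?_, ?_, ?_⟩
  · linear_combination -87/32 * h0 + 87/32 * h1 - 29/32 * h2 - 29/16 * h3 + 7/24 * h4 - 37/400 * h5 + 49/600 * h9 +
      189/800 * h10
  · linear_combination 141/40 * h0 - 141/40 * h1 + 47/40 * h2 + 137/40 * h3 - 21/40 * h4 + 173/1000 * h5 - 77/500 *
      h9 - 56/125 * h10
  · linear_combination 11029/640 * h0 - 5461/320 * h1 + 725/128 * h2 + 44/5 * h3 - 79/60 * h4 + 209/500 * h5 -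
      91/384 * h6 + 74/315 * h7 - 319/1152 * h8 - 323/750 * h9 - 559/500 * h10 - 1/24 * h11 + 1/12
      * h12 + 1/24 * h13 - 3/64 * h14 - 3/32 * h15 + 1/84 * h16 + 9/64 * h17
  · linear_combination 3 * h0 - 3 * h1 + h2
  · linear_combination -5/2 * h0 + 4 * h1 - 3/2 * h2
  · linear_combination 1/2 * h0 - h1 + 1/2 * h2
  · linear_combination 9/20 * h0 - 9/20 * h1 + 3/20 * h2 + 9/10 * h3 - 1/5 * h4 + 21/250 * h5 - 4/125 * h9 - 67/500
      * h10
  · linear_combination 225/32 * h0 - 225/32 * h1 + 75/32 * h2 + 19/16 * h3 - 1/24 * h4 - 1/80 * h5 - 11/120 * h9 -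
      3/32 * h10
  · linear_combination 471/16 * h0 - 57/2 * h1 + 75/8 * h2 + 9 * h3 - h4 + 6/25 * h5 + 3/8 * h6 - 3/8 * h8 - 13/25
      * h9 - 99/100 * h10 - 1/2 * h11 + 1/2 * h12 - 9/32 * h14 + 9/32 * h17
  · linear_combination -321/40 * h0 + 321/40 * h1 - 107/40 * h2 - 87/40 * h3 + 11/40 * h4 - 83/1000 * h5 + 67/500 *
      h9 + 129/500 * h10
  · linear_combination 429/640 * h0 - 141/320 * h1 + 13/128 * h2 + 29/5 * h3 - 59/60 * h4 + 169/500 * h5 - 739/384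
      * h6 - 31/315 * h7 - 199/1152 * h8 - 193/750 * h9 - 197/250 * h10 - 1/24 * h11 - 1/12 * h12
      + 5/24 * h13 + 69/64 * h14 + 33/32 * h15 + 1/84 * h16 + 9/64 * h17
  · linear_combination 2595/32 * h0 - 1299/16 * h1 + 867/32 * h2 + 81/2 * h3 - 6 * h4 + 99/50 * h5 + 33/32 * h6 -
      33/32 * h8 - 51/25 * h9 - 523/100 * h10 + 1/2 * h11 + 1/2 * h13 - 9/8 * h15 + 9/8 * h17
  · linear_combination 1/160 * h0 - 1/80 * h1 + 1/160 * h2 - 1/32 * h6 + 1/45 * h7 + 1/288 * h8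
  · linear_combination 1/32 * h0 + 1/16 * h1 - 1/32 * h2 + 1/32 * h6 - 1/32 * h8 - 1/32 * h14 + 1/32 * h17
  · linear_combination -43/16 * h0 + 85/32 * h1 - 7/8 * h2 - 29/16 * h3 + 7/24 * h4 - 37/400 * h5 - 1/32 * h6 +
      1/32 * h8 + 49/600 * h9 + 189/800 * h10
  · linear_combination -3/4 * h0 + 3/4 * h1 - 1/4 * h2 - 1/4 * h6 + 1/8 * h14 + 1/8 * h15
  · linear_combination 171/40 * h0 - 171/40 * h1 + 57/40 * h2 + 137/40 * h3 - 21/40 * h4 + 173/1000 * h5 + 1/8 * h6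
      - 1/8 * h8 - 77/500 * h9 - 56/125 * h10 - 1/8 * h15 + 1/8 * h17
  · linear_combination 2193/128 * h0 - 5397/320 * h1 + 3561/640 * h2 + 44/5 * h3 - 79/60 * h4 + 209/500 * h5 +
      149/384 * h6 - 38/315 * h7 - 239/1152 * h8 - 323/750 * h9 - 559/500 * h10 - 1/24 * h11 +
      1/12 * h12 + 1/24 * h13 - 3/64 * h14 - 3/32 * h15 + 1/84 * h16 + 9/64 * h17

lemma Q2_no : ¬ ∃ a b c : MvPolynomial (Fin 3) ℂ,
      ¬ (a = 0 ∧ b = 0 ∧ c = 0) ∧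
      a.IsHomogeneous 2 ∧ b.IsHomogeneous 2 ∧ c.IsHomogeneous 2 ∧
      a * pderiv 0 Q2 + b * pderiv 1 Q2 + c * pderiv 2 Q2 = 0 := by
  rintro ⟨a, b, c, h0, ha, hb, hc, h⟩
  obtain ⟨a', ha'⟩ := homog_eval ha
  obtain ⟨b', hb'⟩ := homog_eval hb
  obtain ⟨c', hc'⟩ := homog_eval hc
  have L := Q2_lin a' b' c' (by
    intro x y z
    have e := congrArg (eval ![x, y, z]) h
    rw [Q2_d0, Q2_d1, Q2_d2] at e
    simp only [map_add, map_mul, ha', hb', hc'] at e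
    simp [Finset.sum_range_succ] at e
    linear_combination e)
  obtain ⟨e0, e1, e2, e3, e4, e5, e6, e7, e8, e9, e10, e11, e12, e13, e14, e15, e16, e17⟩ := L
  apply h0
  refine ⟨eq_zero_of_eval ?_, eq_zero_of_eval ?_, eq_zero_of_eval ?_⟩
  · intro x y z
    rw [ha']
    simp [Finset.sum_range_succ, e0, e1, e2, e3, e4, e5]
  · intro x y z
    rw [hb']
    simp [Finset.sum_range_succ, e6, e7, e8, e9, e10, e11]
  · intro x y z
    rw [hc']
    simp [Finset.sum_range_succ, e12, e13, e14, e15, e16, e17]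

set_option maxHeartbeats 4000000 in
lemma Q2_ex : ∃ a b c : MvPolynomial (Fin 3) ℂ,
      ¬ (a = 0 ∧ b = 0 ∧ c = 0) ∧
      a.IsHomogeneous 3 ∧ b.IsHomogeneous 3 ∧ c.IsHomogeneous 3 ∧
      a * pderiv 0 Q2 + b * pderiv 1 Q2 + c * pderiv 2 Q2 = 0 := by
  have hm (i j k : ℕ) (t : ℂ) (hs : i + j + k = 3) :
      (C t * (X 0 ^ i * X 1 ^ j * X 2 ^ k) : MvPolynomial (Fin 3) ℂ).IsHomogeneous 3 := by
    have := (isHomogeneous_C (Fin 3) t).mul ((((isHomogeneous_X_pow (R := ℂ) (0 : Fin 3) i).mul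
      (isHomogeneous_X_pow (1 : Fin 3) j)).mul (isHomogeneous_X_pow (2 : Fin 3) k)))
    rwa [hs, zero_add] at this
  refine ⟨C (-3) * (X 0 ^ 2 * X 1 ^ 0 * X 2 ^ 1) + C (-28) * (X 0 ^ 1 * X 1 ^ 1 * X 2 ^ 1),
    C (-18) * (X 0 ^ 2 * X 1 ^ 0 * X 2 ^ 1) + C (-3) * (X 0 ^ 1 * X 1 ^ 1 * X 2 ^ 1) + C (4) * (X
    0 ^ 0 * X 1 ^ 2 * X 2 ^ 1),
    C (-2) * (X 0 ^ 2 * X 1 ^ 1 * X 2 ^ 0) + C (-3) * (X 0 ^ 1 * X 1 ^ 0 * X 2 ^ 2) + C (4) * (X 0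
    ^ 0 * X 1 ^ 1 * X 2 ^ 2), ?_, ?_, ?_, ?_, ?_⟩
  · rintro ⟨h, -, -⟩
    have e := congrArg (eval ![1, 1, 1]) h
    simp at e
    try norm_num at e
  · repeat' apply IsHomogeneous.add
    all_goals exact hm _ _ _ _ rfl
  · repeat' apply IsHomogeneous.add
    all_goals exact hm _ _ _ _ rfl
  · repeat' apply IsHomogeneous.add
    all_goals exact hm _ _ _ _ rfl
  · rw [Q2_d0, Q2_d1, Q2_d2]
    simp only [map_neg, map_ofNat, map_one]
    ring

lemma mdr_eq {f : MvPolynomial (Fin 3) ℂ} {n : ℕ}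
    (hex : ∃ a b c : MvPolynomial (Fin 3) ℂ,
      ¬ (a = 0 ∧ b = 0 ∧ c = 0) ∧
      a.IsHomogeneous (n + 1) ∧ b.IsHomogeneous (n + 1) ∧ c.IsHomogeneous (n + 1) ∧
      a * pderiv 0 f + b * pderiv 1 f + c * pderiv 2 f = 0)
    (hno : ¬ ∃ a b c : MvPolynomial (Fin 3) ℂ,
      ¬ (a = 0 ∧ b = 0 ∧ c = 0) ∧
      a.IsHomogeneous n ∧ b.IsHomogeneous n ∧ c.IsHomogeneous n ∧
      a * pderiv 0 f + b * pderiv 1 f + c * pderiv 2 f = 0) : mdr f = n + 1 := by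
  apply le_antisymm
  · exact Nat.sInf_le hex
  · refine le_csInf ⟨n + 1, hex⟩ ?_
    intro r hr
    by_contra hlt
    exact hno (rel_up (by omega) hr)

theorem stmt_11 : mdr Q1 = 4 ∧ mdr Q2 = 3 :=
  ⟨mdr_eq Q1_ex Q1_no, mdr_eq Q2_ex Q2_no⟩
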